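/- arXiv:2105.14536 — 3 statements merged into one kernel-verified Lean document; each statement's English description precedes it below -/
import Mathlib

section
/- For every n ≥ 4, the n-th order B-spline kernel φ_n satisfies the fourth moment condition with constant K = (n+1)/80 + n(n+1)/48: Σ_{j∈ℤ} (r−j)⁴ · φ_n(r−j) = (n+1)/80 + n(n+1)/48 for all r ∈ ℝ. In particular, the five-point B-spline (n = 4) has fourth-moment constant 23/48 ≈ 0.479 and the six-point B-spline (n = 5) has fourth-moment constant 7/10. -/
open MeasureTheory

/-- The zeroth-order B-spline kernel: the indicator function of `[-1/2, 1/2]`. -/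
noncomputable def bspline0 : ℝ → ℝ :=
  Set.indicator (Set.Icc (-(1 / 2) : ℝ) (1 / 2)) (fun _ => 1)

/-- The B-spline kernels, defined recursively by convolution against `bspline0`. -/
noncomputable def bspline : ℕ → ℝ → ℝ
  | 0 => bspline0
  | n + 1 => fun r => ∫ s : ℝ, bspline n (r - s) * bspline0 s

/-- The weighted kernel `x ^ k * φ_n x`. -/
noncomputable def bsF (n k : ℕ) (x : ℝ) : ℝ := x ^ k * bspline n x

/-- The continuous moments of the kernel. -/
noncomputable def bsM (n k : ℕ) : ℝ := ∫ x, bsF n k x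

lemma bsF_zero_eq (k : ℕ) : bsF 0 k =
    Set.indicator (Set.Icc (-(1 / 2) : ℝ) (1 / 2)) (fun x => x ^ k) := by
  funext x
  simp only [bsF, bspline, bspline0, Set.indicator_apply]
  split_ifs <;> simp

lemma bsF_zero_integrable (k : ℕ) : Integrable (bsF 0 k) := by
  rw [bsF_zero_eq, integrable_indicator_iff measurableSet_Icc]
  exact (continuous_pow k).continuousOn.integrableOn_Icc

lemma bsF_zero_bound (k : ℕ) (x : ℝ) : ‖bsF 0 k x‖ ≤ 1 := by
  rw [bsF_zero_eq, Set.indicator_apply]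
  split_ifs with h
  · rw [norm_pow, Real.norm_eq_abs]
    apply pow_le_one₀ (abs_nonneg x)
    rw [abs_le]; constructor <;> linarith [h.1, h.2]
  · simp

lemma bsM_zero (k : ℕ) : bsM 0 k = ((1 / 2 : ℝ) ^ (k + 1) - (-(1 / 2)) ^ (k + 1)) / (k + 1) := by
  rw [bsM, bsF_zero_eq, integral_indicator measurableSet_Icc, integral_Icc_eq_integral_Ioc,
    ← intervalIntegral.integral_of_le (by norm_num), integral_pow]

lemma bs_term_integrable {f : ℝ → ℝ} (hf : Integrable f) (k : ℕ) (x : ℝ) :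
    Integrable (fun s => f (x - s) * bsF 0 k s) := by
  refine (hf.comp_sub_left x).mul_bdd (c := 1) (bsF_zero_integrable k).aestronglyMeasurable ?_
  exact Filter.Eventually.of_forall (bsF_zero_bound k)

lemma bsF_succ (n : ℕ) (h : ∀ k, Integrable (bsF n k)) (k : ℕ) (x : ℝ) :
    bsF (n + 1) k x = ∑ i ∈ Finset.range (k + 1),
      (k.choose i : ℝ) * ∫ s, bsF n i (x - s) * bsF 0 (k - i) s := by
  simp_rw [← integral_const_mul]
  rw [← integral_finsetSum]
  · simp only [bsF, bspline]
    rw [← integral_const_mul]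
    congr 1
    funext s
    have : x ^ k = ((x - s) + s) ^ k := by ring
    rw [this, add_pow, Finset.sum_mul]
    refine Finset.sum_congr rfl fun i _ => ?_
    ring
  · intro i _
    exact (bs_term_integrable (h i) _ x).const_mul _

lemma bs_conv (n k l : ℕ) (h : Integrable (bsF n k)) :
    Integrable (fun x => ∫ s, bsF n k (x - s) * bsF 0 l s) ∧
    ∫ x, ∫ s, bsF n k (x - s) * bsF 0 l s = bsM n k * bsM 0 l := by
  have e : (fun x => ∫ s, bsF n k (x - s) * bsF 0 l s) =
      MeasureTheory.convolution (bsF 0 l) (bsF n k) (ContinuousLinearMap.mul ℝ ℝ) volume := by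
    funext x
    simp only [MeasureTheory.convolution, ContinuousLinearMap.mul_apply']
    congr 1; funext s; ring
  rw [e]
  refine ⟨(bsF_zero_integrable l).integrable_convolution _ h, ?_⟩
  rw [integral_convolution _ (bsF_zero_integrable l) h]
  simp [bsM, mul_comm]

lemma bsF_integrable (n : ℕ) : ∀ k, Integrable (bsF n k) := by
  induction n with
  | zero => exact bsF_zero_integrable
  | succ n ih =>
    intro k
    rw [funext (bsF_succ n ih k)]
    exact integrable_finsetSum _ fun i _ => (bs_conv n i _ (ih i)).1.const_mul _

lemma bsM_succ (n k : ℕ) : bsM (n + 1) k =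
    ∑ i ∈ Finset.range (k + 1), (k.choose i : ℝ) * (bsM n i * bsM 0 (k - i)) := by
  rw [bsM, funext (bsF_succ n (bsF_integrable n) k), integral_finsetSum]
  · refine Finset.sum_congr rfl fun i _ => ?_
    rw [integral_const_mul, (bs_conv n i _ (bsF_integrable n i)).2]
  · exact fun i _ => (bs_conv n i _ (bsF_integrable n i)).1.const_mul _

/-- Tiling the line by unit intervals. -/
lemma bs_tile {f : ℝ → ℝ} (hf : Integrable f) (r : ℝ) :
    HasSum (fun j : ℤ => ∫ s, f (r - j - s) * bsF 0 0 s) (∫ x, f x) := by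
  have h := hf.hasSum_intervalIntegral (r - 1 / 2)
  have h2 := (Equiv.neg ℤ).hasSum_iff.mpr h
  refine (congrArg (fun g : ℤ → ℝ => HasSum g (∫ x, f x)) ?_).mpr h2
  funext j
  have e : ∀ s, f (r - j - s) * bsF 0 0 s =
      Set.indicator (Set.Icc (-(1 / 2) : ℝ) (1 / 2)) (fun s => f (r - j - s)) s := by
    intro s
    rw [bsF_zero_eq]
    simp only [Set.indicator_apply]
    split_ifs <;> simp
  simp_rw [e]
  rw [integral_indicator measurableSet_Icc, integral_Icc_eq_integral_Ioc,
    ← intervalIntegral.integral_of_le (by norm_num), intervalIntegral.integral_comp_sub_left]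
  simp only [Function.comp, Equiv.neg_apply, Int.cast_neg]
  congr 1 <;> ring

lemma bs_sum (n i l : ℕ) (h : ∀ᵐ x : ℝ, HasSum (fun j : ℤ => bsF n i (x - j)) (bsM n i)) (r : ℝ) :
    HasSum (fun j : ℤ => ∫ s, bsF n i (r - j - s) * bsF 0 l s) (bsM n i * bsM 0 l) := by
  have hi := bsF_integrable n i
  have key := hasSum_integral_of_summable_integral_norm (μ := volume)
    (F := fun (j : ℤ) s => bsF n i (r - j - s) * bsF 0 l s)
    (fun j => bs_term_integrable hi l _) ?_
  · refine (congrArg (HasSum fun j : ℤ => ∫ s, bsF n i (r - j - s) * bsF 0 l s) ?_).mpr key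
    have h' : ∀ᵐ s : ℝ, HasSum (fun j : ℤ => bsF n i (r - s - j)) (bsM n i) :=
      (Measure.measurePreserving_sub_left volume r).quasiMeasurePreserving.ae h
    rw [show bsM n i * bsM 0 l = ∫ s, bsM n i * bsF 0 l s by rw [integral_const_mul, bsM, bsM]]
    apply integral_congr_ae
    filter_upwards [h'] with s hs
    rw [tsum_mul_right, ← hs.tsum_eq]
    simp_rw [sub_right_comm]
  · refine Summable.of_nonneg_of_le (fun j => integral_nonneg fun s => norm_nonneg _) (fun j => ?_)
      (bs_tile hi.norm r).summable
    refine integral_mono (bs_term_integrable hi l _).norm (bs_term_integrable hi.norm 0 _) fun s => ?_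
    simp only [norm_mul]
    refine mul_le_mul_of_nonneg_left ?_ (norm_nonneg _)
    have hb := bsF_zero_bound l s
    simp only [bsF_zero_eq, Set.indicator_apply] at hb ⊢
    split_ifs at hb ⊢ <;> simp_all

lemma bs_base : ∀ᵐ x : ℝ, HasSum (fun j : ℤ => bsF 0 0 (x - j)) (bsM 0 0) := by
  have hc : (Set.range fun j : ℤ => (j : ℝ) + 1 / 2).Countable := Set.countable_range _
  filter_upwards [hc.ae_notMem volume] with x hx
  have h1 : bsM 0 0 = bsF 0 0 (x - (round x : ℤ)) := by
    have := abs_le.1 (abs_sub_round x)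
    rw [bsM_zero, bsF_zero_eq, Set.indicator_of_mem (by exact ⟨by linarith, by linarith⟩)]
    norm_num
  rw [h1]
  refine hasSum_single (round x) fun j hj => ?_
  rw [bsF_zero_eq, Set.indicator_of_notMem]
  rintro ⟨h2, h3⟩
  have h4 := abs_le.1 (abs_sub_round x)
  rcases lt_or_gt_of_ne hj with h | h
  · have : (j : ℝ) + 1 ≤ round x := by exact_mod_cast h
    exact hx ⟨j, by simp only; linarith⟩
  · have : (round x : ℝ) + 1 ≤ j := by exact_mod_cast h
    exact hx ⟨round x, by simp only; linarith⟩

lemma bs_step (n k : ℕ)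
    (h : ∀ i < k, ∀ᵐ x : ℝ, HasSum (fun j : ℤ => bsF n i (x - j)) (bsM n i)) (r : ℝ) :
    HasSum (fun j : ℤ => bsF (n + 1) k (r - j)) (bsM (n + 1) k) := by
  rw [bsM_succ]
  simp_rw [bsF_succ n (bsF_integrable n) k]
  refine hasSum_sum fun i hi => HasSum.mul_left _ ?_
  rcases Nat.lt_succ_iff_lt_or_eq.1 (Finset.mem_range.1 hi) with hlt | rfl
  · exact bs_sum n i _ (h i hlt) r
  · have h0 : bsM 0 0 = 1 := by rw [bsM_zero]; norm_num
    rw [Nat.sub_self, h0, mul_one]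
    exact bs_tile (bsF_integrable n i) r

lemma bs_ae (n : ℕ) : ∀ k ≤ n, ∀ᵐ x : ℝ, HasSum (fun j : ℤ => bsF n k (x - j)) (bsM n k) := by
  induction n with
  | zero => intro k hk; obtain rfl : k = 0 := by omega
            exact bs_base
  | succ n ih =>
    intro k hk
    exact Filter.Eventually.of_forall (bs_step n k fun i hi => ih i (by omega))

lemma bsM_vals (n : ℕ) : bsM n 0 = 1 ∧ bsM n 1 = 0 ∧ bsM n 2 = ((n : ℝ) + 1) / 12 ∧ bsM n 3 = 0 ∧
    bsM n 4 = ((n : ℝ) + 1) / 80 + (n : ℝ) * ((n : ℝ) + 1) / 48 := by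
  induction n with
  | zero => simp only [bsM_zero]; norm_num
  | succ n ih =>
    obtain ⟨h0, h1, h2, h3, h4⟩ := ih
    refine ⟨?_, ?_, ?_, ?_, ?_⟩ <;> rw [bsM_succ] <;>
      simp [Finset.sum_range_succ, h0, h1, h2, h3, h4, bsM_zero, Nat.choose] <;> norm_num <;> ring

lemma bs_main (n : ℕ) (hn : 4 ≤ n) (r : ℝ) : ∑' j : ℤ, (r - (j : ℝ)) ^ 4 * bspline n (r - j)
        = ((n : ℝ) + 1) / 80 + (n : ℝ) * ((n : ℝ) + 1) / 48 := by
  obtain ⟨m, rfl⟩ : ∃ m, n = m + 1 := ⟨n - 1, by omega⟩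
  rw [← (bsM_vals (m + 1)).2.2.2.2]
  exact (bs_step m 4 (fun i hi => bs_ae m i (by omega)) r).tsum_eq

/-- For `n ≥ 4` the `n`-th order B-spline kernel satisfies the fourth moment condition
with constant `K = (n+1)/80 + n(n+1)/48`; in particular the five-point B-spline (`n = 4`)
has fourth-moment constant `23/48` and the six-point B-spline (`n = 5`) has `7/10`. -/
theorem bspline_fourth_moment :
    (∀ n : ℕ, 4 ≤ n →
      ∀ r : ℝ, ∑' j : ℤ, (r - (j : ℝ)) ^ 4 * bspline n (r - j)
        = ((n : ℝ) + 1) / 80 + (n : ℝ) * ((n : ℝ) + 1) / 48) ∧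
    (∀ r : ℝ, ∑' j : ℤ, (r - (j : ℝ)) ^ 4 * bspline 4 (r - j) = 23 / 48) ∧
    (∀ r : ℝ, ∑' j : ℤ, (r - (j : ℝ)) ^ 4 * bspline 5 (r - j) = 7 / 10) := by
  refine ⟨bs_main, fun r => ?_, fun r => ?_⟩
  · rw [bs_main 4 le_rfl r]; norm_num
  · rw [bs_main 5 (by norm_num) r]; norm_num
end

section
/- An n-th order B-spline satisfies moment conditions up to order n: for every n ≥ 1 and every integer k with 0 ≤ k ≤ n, the function r ↦ Σ_{j∈ℤ} (r−j)^k · φ_n(r−j) is constant on ℝ, and its constant value equals the continuous moment ∫_ℝ x^k · φ_n(x) dx. -/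
open MeasureTheory

lemma bs0_integrable : Integrable bspline0 := by
  unfold bspline0
  rw [integrable_indicator_iff measurableSet_Icc]
  exact integrableOn_const (by simp)

lemma bs_succ (n : ℕ) (r : ℝ) :
    bspline (n + 1) r = ∫ u in (r - 1 / 2)..(r + 1 / 2), bspline n u := by
  have h1 : bspline (n + 1) r = ∫ s : ℝ, bspline n (r - s) * bspline0 s := rfl
  have h2 : (fun s : ℝ => bspline n (r - s) * bspline0 s)
      = Set.indicator (Set.Icc (-(1 / 2) : ℝ) (1 / 2)) (fun s => bspline n (r - s)) := by
    funext s
    unfold bspline0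
    by_cases hs : s ∈ Set.Icc (-(1 / 2) : ℝ) (1 / 2)
    · simp only [Set.indicator_of_mem hs, mul_one]
    · simp only [Set.indicator_of_notMem hs, mul_zero]
  rw [h1, h2, integral_indicator measurableSet_Icc, integral_Icc_eq_integral_Ioc,
    ← intervalIntegral.integral_of_le (by norm_num),
    intervalIntegral.integral_comp_sub_left (fun u => bspline n u)]
  congr 1
  ring

lemma bs_support (n : ℕ) : ∀ x : ℝ, ((n : ℝ) + 1) / 2 < |x| → bspline n x = 0 := by
  induction n with
  | zero =>
    intro x hx
    show bspline0 x = 0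
    unfold bspline0
    apply Set.indicator_of_notMem
    intro h
    have : |x| ≤ 1 / 2 := abs_le.2 ⟨h.1, h.2⟩
    norm_num at hx
    linarith
  | succ n ih =>
    intro x hx
    rw [bs_succ]
    apply intervalIntegral.integral_zero_ae
    refine Filter.Eventually.of_forall fun u hu => ih u ?_
    rw [Set.uIoc_of_le (by linarith)] at hu
    have h1 : |x - u| ≤ 1 / 2 := abs_le.2 ⟨by linarith [hu.2], by linarith [hu.1]⟩
    have h2 : |x| ≤ |x - u| + |u| := by simpa using abs_add_le (x - u) u
    push_cast at hx
    linarith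

lemma bs_integrable (n : ℕ) : Integrable (bspline n) := by
  induction n with
  | zero => exact bs0_integrable
  | succ n ih =>
    have hc : Continuous (bspline (n + 1)) := by
      have h : bspline (n + 1) = fun r => (∫ u in (0 : ℝ)..(r + 1 / 2), bspline n u)
          - ∫ u in (0 : ℝ)..(r - 1 / 2), bspline n u := by
        funext r
        rw [bs_succ, intervalIntegral.integral_interval_sub_left
          ih.intervalIntegrable ih.intervalIntegrable]
      rw [h]
      have hp : Continuous fun b => ∫ u in (0 : ℝ)..b, bspline n u :=
        intervalIntegral.continuous_primitive (fun a b => ih.intervalIntegrable) 0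
      exact (hp.comp (by fun_prop : Continuous fun r : ℝ => r + 1 / 2)).sub
        (hp.comp (by fun_prop : Continuous fun r : ℝ => r - 1 / 2))
    apply hc.integrable_of_hasCompactSupport
    apply HasCompactSupport.intro
      (isCompact_Icc : IsCompact (Set.Icc (-((((n + 1 : ℕ) : ℝ) + 1) / 2)) ((((n + 1 : ℕ) : ℝ) + 1) / 2)))
    intro x hx
    apply bs_support
    by_contra h
    push Not at h
    exact hx ⟨(abs_le.1 h).1, (abs_le.1 h).2⟩

/-- the weighted spline -/
noncomputable def wsp (n k : ℕ) (x : ℝ) : ℝ := x ^ k * bspline n x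

lemma wsp_support (n k : ℕ) (x : ℝ) (hx : ((n : ℝ) + 1) / 2 < |x|) : wsp n k x = 0 := by
  simp [wsp, bs_support n x hx]

lemma wsp_integrable (n k : ℕ) : Integrable (wsp n k) := by
  set A : ℝ := ((n : ℝ) + 1) / 2
  have hs : Function.support (wsp n k) ⊆ Set.Icc (-A) A := by
    intro x hx
    by_contra h
    apply hx
    apply wsp_support
    by_contra h'
    push Not at h'
    exact h ⟨(abs_le.1 h').1, (abs_le.1 h').2⟩
  rw [← integrableOn_iff_integrable_of_support_subset hs]
  exact IntegrableOn.continuousOn_mul (by fun_prop) (bs_integrable n).integrableOn isCompact_Icc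

/-- Locally, the periodization is a finite sum. -/
lemma per_out {f : ℝ → ℝ} {A : ℝ} (hf : ∀ x, A < |x| → f x = 0) {B r : ℝ} (hr : |r| ≤ B)
    {N : ℕ} (hN : A + B ≤ N) {j : ℤ} (hj : j ∉ Finset.Icc (-(N : ℤ)) N) : f (r - j) = 0 := by
  apply hf
  have h1 : (N : ℝ) < |(j : ℝ)| := by
    have : (N : ℤ) < |j| := by
      by_contra h
      push Not at h
      exact hj (Finset.mem_Icc.2 (abs_le.1 h))
    exact_mod_cast this
  have h2 : |(j : ℝ)| ≤ |(j : ℝ) - r| + |r| := by simpa using abs_add_le ((j : ℝ) - r) r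
  rw [abs_sub_comm] at h2
  linarith

lemma per_eq {f : ℝ → ℝ} {A : ℝ} (hf : ∀ x, A < |x| → f x = 0) {B r : ℝ} (hr : |r| ≤ B)
    {N : ℕ} (hN : A + B ≤ N) :
    ∑' j : ℤ, f (r - j) = ∑ j ∈ Finset.Icc (-(N : ℤ)) N, f (r - j) :=
  tsum_eq_sum fun _ hj => per_out hf hr hN hj

lemma abs_le_of_uIcc {a u : ℝ} (hu : u ∈ Set.uIcc a (a + 1)) : |u| ≤ |a| + 1 := by
  rw [Set.uIcc_of_le (by linarith)] at hu
  have h1 : |u - a| ≤ 1 := abs_le.2 ⟨by linarith [hu.1], by linarith [hu.2]⟩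
  have h2 : |u| ≤ |u - a| + |a| := by simpa using abs_add_le (u - a) a
  linarith

lemma per_integral {f : ℝ → ℝ} {A : ℝ} (hf : ∀ x, A < |x| → f x = 0) (hi : Integrable f) (a : ℝ) :
    ∫ x in a..(a + 1), ∑' j : ℤ, f (x - j) = ∫ x, f x := by
  obtain ⟨N, hN⟩ := exists_nat_ge (A + (|a| + 1))
  have h1 : ∫ x in a..(a + 1), ∑' j : ℤ, f (x - j)
      = ∫ x in a..(a + 1), ∑ j ∈ Finset.Icc (-(N : ℤ)) N, f (x - j) :=
    intervalIntegral.integral_congr fun u hu => per_eq hf (abs_le_of_uIcc hu) hN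
  rw [h1, intervalIntegral.integral_finsetSum
    (fun (j : ℤ) _ => (hi.comp_sub_right (j : ℝ)).intervalIntegrable)]
  have h2 := hi.hasSum_intervalIntegral a
  have h3 := (Equiv.neg ℤ).hasSum_iff.2 h2
  rw [← h3.tsum_eq]
  symm
  rw [tsum_eq_sum (s := Finset.Icc (-(N : ℤ)) N)]
  · refine Finset.sum_congr rfl fun j _ => ?_
    rw [intervalIntegral.integral_comp_sub_right]
    simp only [Function.comp, Equiv.neg_apply]
    push_cast
    congr 1 <;> ring
  · intro j hj
    have : ∫ x in a..(a + 1), f (x - j) = 0 := by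
      rw [intervalIntegral.integral_congr (g := fun _ => 0)]
      · simp
      · intro u hu
        exact per_out hf (abs_le_of_uIcc hu) hN hj
    rw [← this, intervalIntegral.integral_comp_sub_right]
    simp only [Function.comp, Equiv.neg_apply]
    push_cast
    congr 1 <;> ring

lemma per_intervalIntegrable {f : ℝ → ℝ} {A : ℝ} (hf : ∀ x, A < |x| → f x = 0)
    (hi : Integrable f) (a : ℝ) :
    IntervalIntegrable (fun x => ∑' j : ℤ, f (x - j)) volume a (a + 1) := by
  obtain ⟨N, hN⟩ := exists_nat_ge (A + (|a| + 1))
  have h : IntervalIntegrable (fun x => ∑ j ∈ Finset.Icc (-(N : ℤ)) N, f (x - j))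
      volume a (a + 1) :=
    (integrable_finsetSum _ (fun (j : ℤ) _ => hi.comp_sub_right (j : ℝ))).intervalIntegrable
  refine h.congr fun u hu => ?_
  exact (per_eq hf (abs_le_of_uIcc (Set.uIoc_subset_uIcc hu)) hN).symm

lemma wsp_succ (n k : ℕ) (r : ℝ) : ∑' j : ℤ, wsp (n + 1) k (r - j)
    = ∑ i ∈ Finset.range (k + 1), ∫ u in (r - 1 / 2)..(r - 1 / 2 + 1),
        ((r - u) ^ (k - i) * (k.choose i : ℝ)) * ∑' j : ℤ, wsp n i (u - j) := by
  set a : ℝ := r - 1 / 2 with ha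
  obtain ⟨N, hN⟩ := exists_nat_ge ((((n + 1 : ℕ) : ℝ) + 1) / 2 + (|r| + |a| + 1))
  have hN' : ((n : ℝ) + 1) / 2 + (|a| + 1) ≤ N := by
    push_cast at hN
    linarith [abs_nonneg r]
  rw [per_eq (wsp_support (n + 1) k) (B := |r| + |a| + 1) (by linarith [abs_nonneg a]) hN]
  have h1 : ∀ i, ∫ u in a..(a + 1), ((r - u) ^ (k - i) * (k.choose i : ℝ)) * ∑' j : ℤ, wsp n i (u - j)
      = ∑ j ∈ Finset.Icc (-(N : ℤ)) N, ∫ u in a..(a + 1),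
        ((r - u) ^ (k - i) * (k.choose i : ℝ)) * wsp n i (u - j) := by
    intro i
    rw [← intervalIntegral.integral_finsetSum]
    · refine intervalIntegral.integral_congr fun u hu => ?_
      simp only [per_eq (wsp_support n i) (abs_le_of_uIcc hu) hN', Finset.mul_sum]
    · intro j _
      exact ((wsp_integrable n i).comp_sub_right (j : ℝ)).intervalIntegrable.continuousOn_mul
        (by fun_prop)
  simp only [h1]
  rw [Finset.sum_comm]
  refine Finset.sum_congr rfl fun j _ => ?_
  rw [← intervalIntegral.integral_finsetSum]
  · have h2 : bspline (n + 1) (r - j) = ∫ u in a..(a + 1), bspline n (u - j) := by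
      rw [bs_succ, intervalIntegral.integral_comp_sub_right]
      congr 1 <;> (rw [ha]; ring)
    rw [wsp, h2, ← intervalIntegral.integral_const_mul]
    refine intervalIntegral.integral_congr fun u _ => ?_
    have h3 : (r - (j : ℝ)) = (u - j) + (r - u) := by ring
    simp only [wsp]
    rw [h3, add_pow, Finset.sum_mul]
    refine Finset.sum_congr rfl fun i _ => ?_
    ring
  · intro i _
    exact ((wsp_integrable n i).comp_sub_right (j : ℝ)).intervalIntegrable.continuousOn_mul
      (by fun_prop)

lemma step (n : ℕ) (h : ∀ k ≤ n, ∃ c : ℝ, ∀ᵐ r : ℝ, ∑' j : ℤ, wsp n k (r - j) = c) :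
    ∀ k ≤ n + 1, ∃ c : ℝ, ∀ r : ℝ, ∑' j : ℤ, wsp (n + 1) k (r - j) = c := by
  intro k hk
  choose! c hc using h
  refine ⟨(∑ i ∈ Finset.range k, (∫ s in (-(1 / 2) : ℝ)..(1 / 2),
      s ^ (k - i) * (k.choose i : ℝ)) * c i) + ∫ x, wsp n k x, fun r => ?_⟩
  rw [wsp_succ, Finset.sum_range_succ]
  congr 1
  · refine Finset.sum_congr rfl fun i hi => ?_
    have hi' : i ≤ n := by have := Finset.mem_range.1 hi; omega
    rw [intervalIntegral.integral_congr_ae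
      (g := fun u => ((r - u) ^ (k - i) * (k.choose i : ℝ)) * c i)]
    · rw [intervalIntegral.integral_mul_const,
        intervalIntegral.integral_comp_sub_left (fun s => s ^ (k - i) * (k.choose i : ℝ))]
      congr 2 <;> ring
    · filter_upwards [hc i hi'] with u hu _
      rw [hu]
  · simp only [Nat.sub_self, pow_zero, Nat.choose_self, Nat.cast_one, one_mul]
    exact per_integral (wsp_support n k) (wsp_integrable n k) _

lemma base : ∀ᵐ r : ℝ, ∑' j : ℤ, wsp 0 0 (r - j) = 1 := by
  have hcount : (Set.range fun m : ℤ => (m : ℝ) + 1 / 2).Countable := Set.countable_range _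
  filter_upwards [hcount.ae_notMem volume] with r hr
  rw [tsum_eq_single (round r)]
  · have := abs_le.1 (abs_sub_round r)
    simp only [wsp, pow_zero, one_mul]
    show bspline0 _ = 1
    unfold bspline0
    have hm : r - (round r : ℝ) ∈ Set.Icc (-(1 / 2) : ℝ) (1 / 2) :=
      ⟨by linarith [this.1], by linarith [this.2]⟩
    exact Set.indicator_of_mem hm _
  · intro j hj
    simp only [wsp, pow_zero, one_mul]
    show bspline0 _ = 0
    unfold bspline0
    apply Set.indicator_of_notMem
    rintro ⟨h1, h2⟩
    apply hj
    have h3 : r - j ≠ 1 / 2 := fun h => hr ⟨j, by simp only []; linarith⟩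
    have h4 : r - j < 1 / 2 := lt_of_le_of_ne h2 h3
    symm
    rw [round_eq, Int.floor_eq_iff]
    constructor <;> linarith

lemma const_ae (n : ℕ) : ∀ k ≤ n, ∃ c : ℝ, ∀ᵐ r : ℝ, ∑' j : ℤ, wsp n k (r - j) = c := by
  induction n with
  | zero =>
    intro k hk
    obtain rfl : k = 0 := by omega
    exact ⟨1, base⟩
  | succ n ih =>
    intro k hk
    obtain ⟨c, hc⟩ := step n ih k hk
    exact ⟨c, Filter.Eventually.of_forall hc⟩

/-- An `n`-th order B-spline satisfies moment conditions up to order `n`: for `0 ≤ k ≤ n`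
the lattice sum `Σ_{j∈ℤ} (r−j)^k·φ_n(r−j)` is constant in `r`, with constant value equal
to the continuous moment `∫ x^k·φ_n(x) dx`. -/
theorem bspline_moment_conditions_up_to_order (n k : ℕ) (hn : 1 ≤ n) (hk : k ≤ n) :
    ∀ r : ℝ, ∑' j : ℤ, (r - (j : ℝ)) ^ k * bspline n (r - j)
      = ∫ x : ℝ, x ^ k * bspline n x := by
  intro r
  obtain ⟨m, rfl⟩ : ∃ m, n = m + 1 := ⟨n - 1, by omega⟩
  obtain ⟨c, hc⟩ := step m (const_ae m) k hk
  have h := per_integral (wsp_support (m + 1) k) (wsp_integrable (m + 1) k) 0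
  simp only [hc] at h
  have h' : c = ∫ x, wsp (m + 1) k x := by simpa using h
  exact (hc r).trans h'
end

section
/- The four-point IB kernel φ satisfies the first moment condition: Σ_{j∈ℤ} (r−j)·φ(r−j) = 0 for all r ∈ ℝ. -/
/-- The four-point IB kernel of Peskin. -/
noncomputable def ibKernel4 (r : ℝ) : ℝ :=
  if |r| ≤ 1 then (1 / 8) * (3 - 2 * |r| + Real.sqrt (1 + 4 * |r| - 4 * r ^ 2))
  else if |r| ≤ 2 then (1 / 8) * (5 - 2 * |r| - Real.sqrt (-7 + 12 * |r| - 4 * r ^ 2))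
  else 0

lemma ibKernel4_inner (x : ℝ) (h : |x| ≤ 1) :
    ibKernel4 x = (1 / 8) * (3 - 2 * |x| + Real.sqrt (1 + 4 * |x| - 4 * |x| ^ 2)) := by
  rw [sq_abs, ibKernel4, if_pos h]

lemma ibKernel4_outer (x : ℝ) (h : 1 ≤ |x|) (h2 : |x| ≤ 2) :
    ibKernel4 x = (1 / 8) * (5 - 2 * |x| - Real.sqrt (-7 + 12 * |x| - 4 * |x| ^ 2)) := by
  rcases h.eq_or_lt with h1 | h1
  · rw [ibKernel4_inner x h1.symm.le, ← h1]
    norm_num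
  · rw [sq_abs, ibKernel4, if_neg (not_le.mpr h1), if_pos h2]

lemma ibKernel4_far (x : ℝ) (h : 2 ≤ |x|) : ibKernel4 x = 0 := by
  rcases h.eq_or_lt with h1 | h1
  · rw [ibKernel4_outer x (by linarith) h1.symm.le, ← h1]
    norm_num
  · rw [ibKernel4, if_neg (by linarith), if_neg (by linarith)]

/-- The four-point IB kernel satisfies the first moment condition. -/
theorem ibKernel4_first_moment :
    ∀ r : ℝ, ∑' j : ℤ, (r - (j : ℝ)) * ibKernel4 (r - j) = 0 := by
  intro r
  obtain ⟨n, s, hr, h0, h1⟩ : ∃ (n : ℤ) (s : ℝ), r = n + s ∧ 0 ≤ s ∧ s < 1 :=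
    ⟨⌊r⌋, Int.fract r, (Int.floor_add_fract r).symm, Int.fract_nonneg r, Int.fract_lt_one r⟩
  rw [tsum_eq_sum (s := {n - 1, n, n + 1, n + 2})]
  · rw [Finset.sum_insert (by simp; omega), Finset.sum_insert (by simp),
      Finset.sum_insert (by simp), Finset.sum_singleton]
    push_cast
    have e1 : r - ((n : ℝ) - 1) = 1 + s := by rw [hr]; ring
    have e2 : r - (n : ℝ) = s := by rw [hr]; ring
    have e3 : r - ((n : ℝ) + 1) = -(1 - s) := by rw [hr]; ring
    have e4 : r - ((n : ℝ) + 2) = -(2 - s) := by rw [hr]; ring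
    have a1 : |1 + s| = 1 + s := abs_of_nonneg (by linarith)
    have a2 : |s| = s := abs_of_nonneg h0
    have a3 : |-(1 - s)| = 1 - s := by rw [abs_neg, abs_of_nonneg (by linarith)]
    have a4 : |-(2 - s)| = 2 - s := by rw [abs_neg, abs_of_nonneg (by linarith)]
    rw [e1, e2, e3, e4, ibKernel4_outer (1 + s) (by linarith) (by linarith),
      ibKernel4_inner s (by linarith), ibKernel4_inner (-(1 - s)) (by linarith),
      ibKernel4_outer (-(2 - s)) (by linarith) (by linarith), a1, a2, a3, a4]
    have q1 : -7 + 12 * (1 + s) - 4 * (1 + s) ^ 2 = 1 + 4 * s - 4 * s ^ 2 := by ring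
    have q3 : 1 + 4 * (1 - s) - 4 * (1 - s) ^ 2 = 1 + 4 * s - 4 * s ^ 2 := by ring
    have q4 : -7 + 12 * (2 - s) - 4 * (2 - s) ^ 2 = 1 + 4 * s - 4 * s ^ 2 := by ring
    rw [q1, q3, q4]
    ring
  · intro j hj
    rw [ibKernel4_far, mul_zero]
    simp only [Finset.mem_insert, Finset.mem_singleton, not_or] at hj
    have : j ≤ n - 2 ∨ n + 3 ≤ j := by omega
    rcases this with h | h
    · have h' : (j : ℝ) ≤ n - 2 := by exact_mod_cast h
      exact le_abs.mpr (Or.inl (by linarith))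
    · have h' : (n : ℝ) + 3 ≤ j := by exact_mod_cast h
      exact le_abs.mpr (Or.inr (by linarith))
end
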